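/- Consider an infinite sequential game (played on an infinite rooted tree, with finitely or countably many players) in which each player has an acyclic preference relation. Then the lazy improvement relation ⇀ is acyclic: there is no finite cycle s₁ ⇀ s₂ ⇀ … ⇀ s_n ⇀ s₁ of strategy profiles. Consequently lazy improvement is a semi-potential. -/

import Mathlib

/-!
An infinite sequential game is modelled on the full infinite rooted tree whose vertices
are the finite sequences (`List M`) of moves in `M`: `d : List M → A` assigns an owner to
each vertex, and `v : (ℕ → M) → O` assigns an outcome to each maximal path (play) from
the root. A strategy profile chooses one outgoing edge at each vertex, i.e. it is a
function `s : List M → M`.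
-/

namespace InfGame

/-- The finite prefix of length `n` of the play induced by a strategy profile `s`. -/
def playPrefix {M : Type*} (s : List M → M) : ℕ → List M
  | 0 => []
  | n+1 => playPrefix s n ++ [s (playPrefix s n)]

/-- The play (maximal path from the root) induced by a strategy profile `s`. -/
def play {M : Type*} (s : List M → M) : ℕ → M :=
  fun n => s (playPrefix s n)

/-- Vertex `h` lies on the play induced by the strategy profile `s`. -/
def OnPlay {M : Type*} (s : List M → M) (h : List M) : Prop :=
  h = playPrefix s h.length

/-- Player `a` can lazily convert `s` into `s'` (`s ⇀ᶜ_a s'`): every vertex at which `s`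
and `s'` differ is owned by `a` and lies on the play induced by `s'`. -/
def LazyConv {A M : Type*} (d : List M → A) (a : A) (s s' : List M → M) : Prop :=
  ∀ h : List M, s h ≠ s' h → d h = a ∧ OnPlay s' h

/-- Player `a` can convert `s` into `s'` (`s ↠ᶜ_a s'`): every vertex at which `s` and
`s'` differ is owned by `a`. -/
def Conv {A M : Type*} (d : List M → A) (a : A) (s s' : List M → M) : Prop :=
  ∀ h : List M, s h ≠ s' h → d h = a

/-- The collective lazy improvement relation `⇀` of an infinite sequential game with
outcome function `v` and preferences `prec`. -/
def Lazy {A M O : Type*} (d : List M → A) (v : (ℕ → M) → O)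
    (prec : A → O → O → Prop) (s s' : List M → M) : Prop :=
  ∃ a : A, LazyConv d a s s' ∧ prec a (v (play s)) (v (play s'))

/-- The collective improvement relation `↠` of an infinite sequential game. -/
def Improve {A M O : Type*} (d : List M → A) (v : (ℕ → M) → O)
    (prec : A → O → O → Prop) (s s' : List M → M) : Prop :=
  ∃ a : A, Conv d a s s' ∧ prec a (v (play s)) (v (play s'))

end InfGame

/-- A relation is acyclic if it admits no finite cycle `x₀ ≺ x₁ ≺ … ≺ x_k ≺ x₀`. -/
def Acyclic {X : Type*} (r : X → X → Prop) : Prop :=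
  ∀ x, ¬ Relation.TransGen r x x

namespace InfGame

theorem playPrefix_length {M : Type*} (s : List M → M) (n : ℕ) :
    (playPrefix s n).length = n := by
  induction n with
  | zero => rfl
  | succ n ih => simp [playPrefix, ih]

theorem playPrefix_move {M : Type*} (s : List M → M) (n : ℕ) :
    ∀ (h : List M) (m : M) (r : List M), playPrefix s n = h ++ m :: r → s h = m := by
  induction n with
  | zero => intro h m r e; simp [playPrefix] at e
  | succ n ih =>
    intro h m r e
    rcases List.eq_nil_or_concat r with rfl | ⟨r', y, rfl⟩
    · have := List.append_inj' (t₁ := [s (playPrefix s n)]) (t₂ := [m]) e rfl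
      obtain ⟨h1, h2⟩ := this
      rw [← h1]; simpa using h2
    · have e' : playPrefix s n ++ [s (playPrefix s n)] = (h ++ m :: r') ++ [y] := by
        simpa [playPrefix] using e
      exact ih h m r' (List.append_inj' e' rfl).1

/-- `s` follows the moves `l` starting from `h`. -/
def Follows {M : Type*} (s : List M → M) : List M → List M → Prop
  | _, [] => True
  | h, m :: l => s h = m ∧ Follows s (h ++ [m]) l

theorem follows_congr {M : Type*} (s t : List M → M) (l : List M) :
    ∀ h, (∀ r, s (h ++ r) = t (h ++ r)) → (Follows s h l ↔ Follows t h l) := by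
  induction l with
  | nil => intro h _; simp [Follows]
  | cons m l ih =>
    intro h e
    have h0 := e []
    simp only [List.append_nil] at h0
    simp only [Follows, h0]
    rw [ih (h ++ [m]) (fun r => by simpa using e (m :: r))]

theorem follows_iff {M : Type*} (s : List M → M) (l : List M) :
    ∀ k, Follows s (playPrefix s k) l ↔ playPrefix s (k + l.length) = playPrefix s k ++ l := by
  induction l with
  | nil => intro k; simp [Follows]
  | cons m l ih =>
    intro k
    constructor
    · rintro ⟨h1, h2⟩
      have e : playPrefix s k ++ [m] = playPrefix s (k + 1) := by simp [playPrefix, h1]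
      rw [e, ih] at h2
      rw [← e] at h2
      have : k + (m :: l).length = k + 1 + l.length := by simp; omega
      rw [this, h2]; simp
    · intro h
      have h1 := playPrefix_move s _ _ _ _ h
      have e : playPrefix s k ++ [m] = playPrefix s (k + 1) := by simp [playPrefix, h1]
      refine ⟨h1, ?_⟩
      rw [e, ih, ← e]
      have : k + (m :: l).length = k + 1 + l.length := by simp; omega
      rw [← this, h]; simp

open Classical in
/-- Indicator of following `l` from `h`. -/
noncomputable def ind {M : Type*} (s : List M → M) (h l : List M) : ℤ :=
  if Follows s h l then 1 else 0

open Classical in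
/-- The potential of the coalition `S` for the path `l` from `h`. -/
noncomputable def pot {A M : Type*} (d : List M → A) (s : List M → M) :
    List M → List M → Set A → ℤ
  | _, [], _ => 0
  | h, m :: l, S =>
    if d h ∈ S then ind s h (m :: l) - pot d s (h ++ [m]) l Sᶜ
    else pot d s (h ++ [m]) l S

theorem ind_cons_of_eq {M : Type*} (s : List M → M) (h l : List M) (m : M) (e : s h = m) :
    ind s h (m :: l) = ind s (h ++ [m]) l := by
  have : Follows s h (m :: l) ↔ Follows s (h ++ [m]) l := by simp [Follows, e]
  by_cases hf : Follows s (h ++ [m]) l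
  · simp only [ind, this.2 hf, hf, if_true]
  · simp only [ind, mt this.1 hf, hf, if_false]

theorem ind_cons_of_ne {M : Type*} (s : List M → M) (h l : List M) (m : M) (e : s h ≠ m) :
    ind s h (m :: l) = 0 := by
  simp [ind, Follows, e]

theorem ind_step {A M : Type*} (d : List M → A) (a : A) (s s' : List M → M)
    (hl : LazyConv d a s s') (h l : List M) (m : M) (hd : d h ≠ a) :
    ind s' h (m :: l) - ind s h (m :: l) = ind s' (h ++ [m]) l - ind s (h ++ [m]) l := by
  have e : s h = s' h := by
    by_contra hne
    exact hd (hl h hne).1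
  by_cases hm : s' h = m
  · rw [ind_cons_of_eq _ _ _ _ hm, ind_cons_of_eq _ _ _ _ (e.trans hm)]
  · rw [ind_cons_of_ne _ _ _ _ hm, ind_cons_of_ne _ _ _ _ (by rwa [e])]
    have : Follows s (h ++ [m]) l ↔ Follows s' (h ++ [m]) l := by
      apply follows_congr
      intro r
      by_contra hne
      have h2 := (hl _ hne).2
      unfold OnPlay at h2
      apply hm
      refine playPrefix_move s' _ h m r (h2.symm.trans ?_)
      simp
    by_cases hf : Follows s (h ++ [m]) l
    · simp [ind, this.1 hf, hf]
    · simp [ind, mt this.2 hf, hf]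

theorem pot_step {A M : Type*} (d : List M → A) (a : A) (s s' : List M → M)
    (hl : LazyConv d a s s') (l : List M) : ∀ (h : List M) (S : Set A),
    (a ∈ S → pot d s' h l S - pot d s h l S = ind s' h l - ind s h l) ∧
    (a ∉ S → pot d s' h l S = pot d s h l S) := by
  induction l with
  | nil => intro h S; simp [pot, ind, Follows]
  | cons m l ih =>
    intro h S
    by_cases hd : d h ∈ S
    · simp only [pot, hd, if_true]
      constructor
      · intro ha
        have := (ih (h ++ [m]) Sᶜ).2 (by simpa using ha)
        omega
      · intro ha
        have h1 := (ih (h ++ [m]) Sᶜ).1 ha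
        have h2 := ind_step d a s s' hl h l m (fun e => ha (e ▸ hd))
        omega
    · simp only [pot, hd, if_false]
      constructor
      · intro ha
        have h1 := (ih (h ++ [m]) S).1 ha
        have h2 := ind_step d a s s' hl h l m (fun e => hd (e ▸ ha))
        omega
      · exact (ih (h ++ [m]) S).2

theorem exists_path {X : Type*} {r : X → X → Prop} {x y : X} (h : Relation.TransGen r x y) :
    ∃ (n : ℕ) (f : ℕ → X), f 0 = x ∧ f (n + 1) = y ∧ ∀ i ≤ n, r (f i) (f (i + 1)) := by
  induction h with
  | @single y h => exact ⟨0, fun i => if i = 0 then x else y, by simp, by simp, by simpa using h⟩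
  | @tail y z _ h ih =>
    obtain ⟨n, f, h0, h1, h2⟩ := ih
    refine ⟨n + 1, fun i => if i ≤ n + 1 then f i else z, by simpa using h0, by simp, ?_⟩
    intro i hi
    rcases Nat.lt_or_ge i (n + 1) with hlt | hge
    · have : i + 1 ≤ n + 1 := hlt
      simp only [hi, this, if_true]
      exact h2 i (by omega)
    · have : i = n + 1 := by omega
      subst this
      simpa [h1] using h

theorem playPrefix_eq_play {M : Type*} (s t : List M → M) (N : ℕ)
    (h : playPrefix s N = playPrefix t N) : ∀ k < N, play s k = play t k := by
  induction N with
  | zero => intro k hk; omega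
  | succ N ih =>
    intro k hk
    have := List.append_inj' (t₁ := [s (playPrefix s N)]) (t₂ := [t (playPrefix t N)]) h rfl
    rcases Nat.lt_succ_iff_lt_or_eq.1 hk with hk | rfl
    · exact ih this.1 k hk
    · simpa [play] using this.2

theorem play_eq_playPrefix {M : Type*} (s t : List M → M) (h : play s = play t) (N : ℕ) :
    playPrefix s N = playPrefix t N := by
  induction N with
  | zero => rfl
  | succ N ih =>
    have := congrFun h N
    simp only [play] at this
    simp only [playPrefix]
    rw [this, ih]

theorem lazy_acyclic {A M O : Type*}
    (d : List M → A) (v : (ℕ → M) → O) (prec : A → O → O → Prop)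
    (hacyc : ∀ a : A, ∀ x, ¬ Relation.TransGen (prec a) x x)
    (s : List M → M) (hs : Relation.TransGen (Lazy d v prec) s s) : False := by
  obtain ⟨n, f, h0, h1, h2⟩ := exists_path hs
  have hA : Nonempty A := ⟨(h2 0 (Nat.zero_le _)).choose⟩
  have h3 : ∀ i, ∃ a, i ≤ n → LazyConv d a (f i) (f (i + 1)) ∧
      prec a (v (play (f i))) (v (play (f (i + 1)))) := by
    intro i
    by_cases hi : i ≤ n
    · obtain ⟨a, ha⟩ := h2 i hi
      exact ⟨a, fun _ => ha⟩
    · exact ⟨hA.some, fun h => absurd h hi⟩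
  choose a ha using h3
  let I := {i : Fin (n + 1) // a i = a 0}
  let R : I → I → Prop := fun i j =>
    Relation.TransGen (prec (a 0)) (v (play (f (j.1.1 + 1)))) (v (play (f (i.1.1 + 1))))
  have hT : IsTrans I R := ⟨fun i j k hij hjk => Relation.TransGen.trans hjk hij⟩
  have hI : Std.Irrefl R := ⟨fun i h => hacyc _ _ h⟩
  have wf : WellFounded R := Finite.wellFounded_of_trans_of_irrefl R
  obtain ⟨j, -, hj⟩ := wf.has_min Set.univ ⟨⟨0, rfl⟩, trivial⟩
  obtain ⟨⟨j, hjn⟩, hja⟩ := j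
  simp only at hja
  have hq : ∀ i ≤ n, a i = a 0 → play (f i) ≠ play (f (j + 1)) := by
    intro i hi hia e
    have := (ha i hi).2
    rw [hia, e] at this
    exact hj ⟨⟨i, by omega⟩, hia⟩ trivial (Relation.TransGen.single this)
  have hN : ∀ᶠ N in Filter.atTop, ∀ i ∈ Finset.range (n + 2),
      playPrefix (f i) N = playPrefix (f (j + 1)) N → play (f i) = play (f (j + 1)) := by
    rw [Filter.eventually_all_finset]
    intro i _
    by_cases e : play (f i) = play (f (j + 1))
    · exact Filter.Eventually.of_forall fun _ _ => e
    · obtain ⟨k, hk⟩ := Function.ne_iff.1 e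
      filter_upwards [Filter.eventually_gt_atTop k] with N hkN h
      exact absurd (playPrefix_eq_play _ _ N h k hkN) hk
  obtain ⟨N, hN⟩ := hN.exists
  let q := playPrefix (f (j + 1)) N
  have hqlen : q.length = N := playPrefix_length _ _
  have hF : ∀ t : List M → M, Follows t [] q ↔ playPrefix t N = q := by
    intro t
    have := follows_iff t q 0
    simpa [playPrefix, hqlen] using this
  have hind : ∀ i ≤ n, a i = a 0 → ind (f i) [] q = 0 := by
    intro i hi hia
    have : ¬ Follows (f i) [] q := fun h =>
      hq i hi hia (hN i (by simp; omega) ((hF _).1 h))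
    simp [ind, this]
  have hnn : ∀ t : List M → M, 0 ≤ ind t [] q := by
    intro t; unfold ind; split_ifs <;> simp
  let P : ℕ → ℤ := fun i => pot d (f i) [] q {a 0}
  have hmono : ∀ i ≤ n, P i ≤ P (i + 1) := by
    intro i hi
    have hp := pot_step d (a i) _ _ (ha i hi).1 q [] {a 0}
    by_cases hia : a i = a 0
    · have := hp.1 hia
      have e1 := hind i hi hia
      have e2 := hnn (f (i + 1))
      simp only [P]; omega
    · exact (hp.2 hia).ge
  have hstrict : P j < P (j + 1) := by
    have hp := (pot_step d (a j) _ _ (ha j (by omega)).1 q [] {a 0}).1 hja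
    have e1 := hind j (by omega) hja
    have e2 : ind (f (j + 1)) [] q = 1 := by
      have : Follows (f (j + 1)) [] q := (hF _).2 rfl
      simp [ind, this]
    simp only [P]; omega
  have hup : ∀ k, ∀ i, i + k ≤ n + 1 → P i ≤ P (i + k) := by
    intro k
    induction k with
    | zero => intro i _; simp
    | succ k ih =>
      intro i hi
      exact (ih i (by omega)).trans (hmono (i + k) (by omega))
  have u1 := hup j 0 (by omega)
  have u2 := hup (n - j) (j + 1) (by omega)
  have e3 : j + 1 + (n - j) = n + 1 := by omega
  have e4 : P 0 = P (n + 1) := by simp only [P, h0, h1]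
  rw [e3] at u2
  rw [Nat.zero_add] at u1
  omega

theorem lazy_realize {A M O : Type*}
    (d : List M → A) (v : (ℕ → M) → O) (prec : A → O → O → Prop)
    (s s' : List M → M) (h : Improve d v prec s s') :
    ∃ s'' : List M → M, Lazy d v prec s s'' ∧ v (play s'') = v (play s') := by
  classical
  obtain ⟨a, hc, hp⟩ := h
  let t : List M → M := fun h => if OnPlay s' h then s' h else s h
  have ht : ∀ n, t (playPrefix s' n) = s' (playPrefix s' n) := by
    intro n
    have : OnPlay s' (playPrefix s' n) := by unfold OnPlay; rw [playPrefix_length]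
    simp [t, this]
  have hpre : ∀ n, playPrefix t n = playPrefix s' n := by
    intro n
    induction n with
    | zero => rfl
    | succ n ih => simp only [playPrefix, ih, ht]
  have hplay : play t = play s' := by
    funext n
    simp only [play, hpre, ht]
  refine ⟨t, ⟨a, ?_, by rwa [hplay]⟩, by rw [hplay]⟩
  intro h hne
  by_cases ho : OnPlay s' h
  · have e : t h = s' h := by simp [t, ho]
    rw [e] at hne
    refine ⟨hc h hne, ?_⟩
    unfold OnPlay at ho ⊢
    rwa [hpre]
  · exact absurd (by simp [t, ho]) hne

end InfGame

open InfGame in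
/-- In an infinite sequential game with (at most) countably many players in which every
player has an acyclic preference relation, the lazy improvement relation `⇀` is acyclic;
consequently (together with the realizability of outcomes) it is a semi-potential. -/
theorem infinite_lazy_improvement_is_semipotential {A M O : Type*} [Countable A]
    (d : List M → A) (v : (ℕ → M) → O) (prec : A → O → O → Prop)
    (hacyc : ∀ a : A, Acyclic (prec a)) :
    Acyclic (Lazy d v prec)
    ∧ (∀ s s' : List M → M, Lazy d v prec s s' → Improve d v prec s s')
    ∧ (∀ s s' : List M → M, Improve d v prec s s' →
        ∃ s'' : List M → M, Lazy d v prec s s'' ∧ v (play s'') = v (play s')) := by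
  exact ⟨fun s hs => lazy_acyclic d v prec hacyc s hs,
    fun s s' ⟨a, h, hp⟩ => ⟨a, fun x hx => (h x hx).1, hp⟩,
    fun s s' h => lazy_realize d v prec s s' h⟩
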